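/- Let L be a stable ternary lattice. For an odd prime p: if ord_p(d_L)=0 then L_p ≅ ⟨1,1,d_L⟩; if ord_p(d_L)=1 and L_p is isotropic then L_p ≅ ⟨1,−1,−d_L⟩; if ord_p(d_L)=1 and L_p is anisotropic then L_p ≅ ⟨1,−Δ_p,−Δ_p d_L⟩, where Δ_p is a non-square unit in ℤ_p. For p=2: if L_2 is anisotropic then L_2 ≅ 𝔸 ⊥ ⟨3d_L⟩, and otherwise L_2 ≅ ℍ ⊥ ⟨−d_L⟩, where 𝔸 is the binary ℤ_2-lattice with Gram matrix [[2,1],[1,2]] and ℍ the one with Gram matrix [[0,1],[1,0]]. -/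

import Mathlib

open scoped BigOperators Classical
open Matrix Filter

noncomputable section

/-! ## Binary quadratic forms, class numbers, and Hurwitz class numbers -/

/-- `(a,b,c)` represents the primitive positive-definite binary quadratic form
`a x² + b x y + c y²` of discriminant `d`. -/
def IsPrimPosDefBQF (d : ℤ) (f : ℤ × ℤ × ℤ) : Prop :=
  f.2.1 ^ 2 - 4 * f.1 * f.2.2 = d ∧ Int.gcd f.1 (Int.gcd f.2.1 f.2.2) = 1 ∧ 0 < f.1

/-- `SL₂(ℤ)`-equivalence of binary quadratic forms. -/
def BQFEquiv (f g : ℤ × ℤ × ℤ) : Prop :=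
  ∃ M : Matrix.SpecialLinearGroup (Fin 2) ℤ,
    g.1 = f.1 * M 0 0 ^ 2 + f.2.1 * M 0 0 * M 1 0 + f.2.2 * M 1 0 ^ 2 ∧
    g.2.1 = 2 * f.1 * M 0 0 * M 0 1 + f.2.1 * (M 0 0 * M 1 1 + M 0 1 * M 1 0) +
        2 * f.2.2 * M 1 0 * M 1 1 ∧
    g.2.2 = f.1 * M 0 1 ^ 2 + f.2.1 * M 0 1 * M 1 1 + f.2.2 * M 1 1 ^ 2

/-- The class number `h(d)`: the number of `SL₂(ℤ)`-classes of primitive positive-definite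
binary quadratic forms of discriminant `d`. -/
def classNum (d : ℤ) : ℕ :=
  Nat.card (Quot fun f g : {f : ℤ × ℤ × ℤ // IsPrimPosDefBQF d f} => BQFEquiv f.1 g.1)

/-- The number of automorphs `w_d`. -/
def wAut (d : ℤ) : ℕ := if d = -3 then 6 else if d = -4 then 4 else 2

def hurwitzNat (N : ℕ) : ℚ :=
  if 0 < N ∧ (N % 4 = 0 ∨ N % 4 = 3) then
    ∑ f ∈ N.divisors.filter fun f => f ^ 2 ∣ N,
      (classNum (-((N / f ^ 2 : ℕ) : ℤ)) : ℚ) / ((wAut (-((N / f ^ 2 : ℕ) : ℤ)) : ℚ) / 2)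
  else 0

/-- Hurwitz class number, with the convention `H(x) = 0` unless `x` is a positive integer
congruent to `0` or `3 (mod 4)`. -/
def hurwitz (x : ℚ) : ℚ := if x.den = 1 ∧ 0 ≤ x.num then hurwitzNat x.num.toNat else 0

/-! ## Kronecker symbol and fundamental discriminants -/

def kron2 (a : ℤ) : ℤ := if a % 2 = 0 then 0 else if a % 8 = 1 ∨ a % 8 = 7 then 1 else -1

/-- The Kronecker symbol `(a / n)` for `n ∈ ℕ`. -/
def kroneckerSym (a : ℤ) (n : ℕ) : ℤ :=
  kron2 a ^ padicValNat 2 n * jacobiSym a (n / 2 ^ padicValNat 2 n)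

/-- Fundamental discriminants. -/
def IsFundamentalDisc (d : ℤ) : Prop :=
  d % 4 = 1 ∧ Squarefree d ∨ d % 4 = 0 ∧ Squarefree (d / 4) ∧ (d / 4 % 4 = 2 ∨ d / 4 % 4 = 3)

/-! ## Ternary quadratic lattices via Gram matrices -/

abbrev TernMat := Matrix (Fin 3) (Fin 3) ℤ

/-- The quadratic form attached to a Gram matrix. -/
def quadVal {R : Type*} [CommRing R] {k : ℕ} (M : Matrix (Fin k) (Fin k) R) (x : Fin k → R) : R :=
  ∑ i, ∑ j, x i * M i j * x j

/-- `A` is the Gram matrix of a positive-definite integral ternary lattice. -/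
def IsLat (A : TernMat) : Prop := A.IsSymm ∧ ∀ x : Fin 3 → ℤ, x ≠ 0 → 0 < quadVal A x

/-- The number of representations of `n` by the lattice with Gram matrix `A`. -/
def rRep (n : ℤ) (A : TernMat) : ℕ := Nat.card {x : Fin 3 → ℤ // quadVal A x = n}

/-- Isometry of ternary lattices via their Gram matrices. -/
def LatIsom (A B : TernMat) : Prop := ∃ U : TernMat, IsUnit U.det ∧ Uᵀ * A * U = B

/-- The number of automorphs `o(L)`. -/
def numAut (A : TernMat) : ℕ := Nat.card {U : TernMat // IsUnit U.det ∧ Uᵀ * A * U = A}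

def padicMat (p : ℕ) [Fact p.Prime] {k : ℕ} (A : Matrix (Fin k) (Fin k) ℤ) :
    Matrix (Fin k) (Fin k) ℤ_[p] := A.map Int.cast

/-- Isometry of `ℤ_p`-lattices given by Gram matrices. -/
def PadicIsomP (p : ℕ) [Fact p.Prime] {k : ℕ} (M N : Matrix (Fin k) (Fin k) ℤ_[p]) : Prop :=
  ∃ U : Matrix (Fin k) (Fin k) ℤ_[p], IsUnit U.det ∧ Uᵀ * M * U = N

/-- `A ⊗ ℤ_p ≅ B ⊗ ℤ_p`. -/
def PadicLatIsom (p : ℕ) (hp : p.Prime) (A B : TernMat) : Prop :=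
  letI : Fact p.Prime := ⟨hp⟩
  PadicIsomP p (padicMat p A) (padicMat p B)

/-- `B` is (the Gram matrix of a lattice) in the genus of `A`. -/
def InGenus (A B : TernMat) : Prop :=
  IsLat B ∧ ∀ (p : ℕ) (hp : p.Prime), PadicLatIsom p hp A B

/-- The mass `w(L)` of the genus of `A`. -/
def massOf (A : TernMat) : ℝ :=
  ∑ᶠ c : Quot fun B C : {B : TernMat // InGenus A B} => LatIsom B.1 C.1,
    ((numAut (Quot.out c).1 : ℝ))⁻¹

/-- The Siegel–Weil average `r(n, gen(L))`. -/
def rGenus (n : ℤ) (A : TernMat) : ℝ :=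
  (massOf A)⁻¹ *
    ∑ᶠ c : Quot fun B C : {B : TernMat // InGenus A B} => LatIsom B.1 C.1,
      (rRep n (Quot.out c).1 : ℝ) / (numAut (Quot.out c).1 : ℝ)

/-! ## Local invariants -/

/-- `L_p` is isotropic. -/
def IsotropicP (p : ℕ) [Fact p.Prime] (A : TernMat) : Prop :=
  ∃ x : Fin 3 → ℤ_[p], x ≠ 0 ∧ quadVal (padicMat p A) x = 0

/-- The modified Hasse symbol `S_p*(L)`: `1` if `L_p` is isotropic, `-1` if anisotropic. -/
def SpStar (p : ℕ) (A : TernMat) : ℤ :=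
  if h : p.Prime then
    letI : Fact p.Prime := ⟨h⟩
    if IsotropicP p A then 1 else -1
  else 1

/-- The lattice is even: all represented numbers are even. -/
def IsEvenLat (A : TernMat) : Prop := ∀ x : Fin 3 → ℤ, 2 ∣ quadVal A x

/-- The lattice is primitive: its scale ideal is `ℤ`. -/
def IsPrimitiveLat (A : TernMat) : Prop :=
  Finset.univ.gcd (fun ij : Fin 3 × Fin 3 => (A ij.1 ij.2).natAbs) = 1

/-- Stability at a prime `p`. -/
def StableAt (A : TernMat) (p : ℕ) : Prop :=
  padicValInt p A.det ≤ 1 ∧ (p = 2 → (padicValInt 2 A.det = 1 ↔ IsEvenLat A))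

/-- A stable (primitive) ternary lattice. -/
def IsStable (A : TernMat) : Prop := IsPrimitiveLat A ∧ ∀ p : ℕ, p.Prime → StableAt A p

def RepresentedAt (p : ℕ) (hp : p.Prime) (n : ℤ) (A : TernMat) : Prop :=
  letI : Fact p.Prime := ⟨hp⟩
  ∃ x : Fin 3 → ℤ_[p], quadVal (padicMat p A) x = (n : ℤ_[p])

/-- `n` is represented by `L_p` for every prime `p`. -/
def LocallyRepresented (n : ℤ) (A : TernMat) : Prop :=
  ∀ (p : ℕ) (hp : p.Prime), RepresentedAt p hp n A

/-! ## Siegel local densities -/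

/-- The Siegel local density `α_p(n, L)` (here `s = 1`, `t = 3`). -/
def localDensity (p : ℕ) (hp : p.Prime) (n : ℤ) (A : TernMat) : ℝ :=
  limUnder atTop fun r : ℕ =>
    (Nat.card {X : Fin 3 → ZMod (p ^ r) //
        (∑ i, ∑ j, X i * (A i j : ZMod (p ^ r)) * X j) = (n : ZMod (p ^ r))} : ℝ) /
      (p : ℝ) ^ (2 * r)

def localDensityN (p : ℕ) (n : ℤ) (A : TernMat) : ℝ :=
  if h : p.Prime then localDensity p h n A else 0

/-- The value `L(1, χ_a)` of the Dirichlet series attached to the Kronecker symbol `(a/·)`. -/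
def LOne (a : ℤ) : ℝ :=
  limUnder atTop fun N : ℕ =>
    ∑ k ∈ Finset.range N, (kroneckerSym a (k + 1) : ℝ) / (k + 1)

/-! ## Watson transformations (Gram matrix form) -/

/-- The underlying set of `Λ_m(L)` in the coordinates of `L`. -/
def watsonSetG (m : ℕ) (A : TernMat) : Set (Fin 3 → ℤ) :=
  {x | ∀ y : Fin 3 → ℤ, (m : ℤ) ∣ (quadVal A (x + y) - quadVal A y)}

/-- `B` is a Gram matrix for the sublattice `Λ_m(L)` of the lattice `L` with Gram matrix `A`. -/
def IsWatsonGram (m : ℕ) (A B : TernMat) : Prop :=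
  ∃ T : TernMat, Set.range T.mulVec = watsonSetG m A ∧ B = Tᵀ * A * T

/-- `B` is a Gram matrix of the Watson transform `λ_m(L)`: the primitive rescaling of `Λ_m(L)`. -/
def IsLambdaGram (m : ℕ) (A B : TernMat) : Prop :=
  IsPrimitiveLat B ∧
    ∃ (B₀ : TernMat) (c : ℚ), 0 < c ∧ IsWatsonGram m A B₀ ∧
      B.map ((↑) : ℤ → ℚ) = c • B₀.map ((↑) : ℤ → ℚ)

/-- The `3×3` Gram matrix of the orthogonal sum `M ⊥ U`. -/
def blockMat3 {p : ℕ} [Fact p.Prime] (k : ℕ) (hk : k ≤ 3)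
    (M : Matrix (Fin k) (Fin k) ℤ_[p]) (U : Matrix (Fin (3 - k)) (Fin (3 - k)) ℤ_[p]) :
    Matrix (Fin 3) (Fin 3) ℤ_[p] :=
  Matrix.reindex (finSumFinEquiv.trans (finCongr (by omega)))
    (finSumFinEquiv.trans (finCongr (by omega))) (Matrix.fromBlocks M 0 0 U)

end

/-! ## Helper lemmas -/

section helpers

variable {p : ℕ} [Fact p.Prime]

/-- The symmetric matrix with given upper triangle. -/
def symMat (a b c d e f : ℤ_[p]) : Matrix (Fin 3) (Fin 3) ℤ_[p] := !![a, b, c; b, d, e; c, e, f]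

lemma symMat_det (a b c d e f : ℤ_[p]) :
    (symMat a b c d e f).det = a * d * f + 2 * b * c * e - a * e ^ 2 - d * c ^ 2 - f * b ^ 2 := by
  simp [symMat, Matrix.det_fin_three]; ring

lemma isUnit_iff_not_dvd (x : ℤ_[p]) : IsUnit x ↔ ¬ (p : ℤ_[p]) ∣ x := by
  rw [← PadicInt.norm_lt_one_iff_dvd, ← PadicInt.not_isUnit_iff, not_not]

lemma prime_p : Prime (p : ℤ_[p]) := PadicInt.prime_p

lemma isomP_trans {M N K : Matrix (Fin 3) (Fin 3) ℤ_[p]} (h : PadicIsomP p M N)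
    (h' : PadicIsomP p N K) : PadicIsomP p M K := by
  obtain ⟨U, hU, rfl⟩ := h
  obtain ⟨V, hV, rfl⟩ := h'
  refine ⟨U * V, ?_, ?_⟩
  · rw [Matrix.det_mul]; exact hU.mul hV
  · simp only [Matrix.transpose_mul, Matrix.mul_assoc]

lemma isomP_symm {M N : Matrix (Fin 3) (Fin 3) ℤ_[p]} (h : PadicIsomP p M N) :
    PadicIsomP p N M := by
  obtain ⟨U, hU, rfl⟩ := h
  refine ⟨U⁻¹, ?_, ?_⟩
  · rw [Matrix.det_nonsing_inv]; exact hU.ringInverse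
  · have h1 : U * U⁻¹ = 1 := Matrix.mul_nonsing_inv U hU
    have h2 : U⁻¹ᵀ * Uᵀ = 1 := by rw [← Matrix.transpose_mul, h1, Matrix.transpose_one]
    calc U⁻¹ᵀ * (Uᵀ * M * U) * U⁻¹ = (U⁻¹ᵀ * Uᵀ) * M * (U * U⁻¹) := by
          simp only [Matrix.mul_assoc]
      _ = M := by rw [h1, h2]; simp

lemma isomP_det {M N : Matrix (Fin 3) (Fin 3) ℤ_[p]} (h : PadicIsomP p M N) :
    ∃ u : ℤ_[p], IsUnit u ∧ N.det = u ^ 2 * M.det := by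
  obtain ⟨U, hU, rfl⟩ := h
  refine ⟨U.det, hU, ?_⟩
  simp only [Matrix.det_mul, Matrix.det_transpose]; ring

/-- Isotropy of a Gram matrix. -/
def isoMat (M : Matrix (Fin 3) (Fin 3) ℤ_[p]) : Prop :=
  ∃ x : Fin 3 → ℤ_[p], x ≠ 0 ∧ quadVal M x = 0

lemma quadVal_eq (M : Matrix (Fin 3) (Fin 3) ℤ_[p]) (x : Fin 3 → ℤ_[p]) :
    quadVal M x = x ⬝ᵥ (M *ᵥ x) := by
  simp [quadVal, dotProduct, Matrix.mulVec, Finset.mul_sum, mul_assoc]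

lemma isoMat_of_isom {M N : Matrix (Fin 3) (Fin 3) ℤ_[p]} (h : PadicIsomP p M N)
    (hN : isoMat N) : isoMat M := by
  obtain ⟨U, hU, rfl⟩ := h
  obtain ⟨x, hx, hq⟩ := hN
  refine ⟨U *ᵥ x, ?_, ?_⟩
  · intro h0
    exact hx (Matrix.eq_zero_of_mulVec_eq_zero hU.ne_zero h0)
  · rw [quadVal_eq] at hq ⊢
    rw [← hq, ← Matrix.mulVec_mulVec, ← Matrix.mulVec_mulVec,
      Matrix.dotProduct_mulVec x, Matrix.vecMul_transpose]

lemma isoMat_iff {M N : Matrix (Fin 3) (Fin 3) ℤ_[p]} (h : PadicIsomP p M N) :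
    isoMat M ↔ isoMat N :=
  ⟨isoMat_of_isom (isomP_symm h), isoMat_of_isom h⟩

/-- Change of basis with columns `(x1,y1,z1)`, `(x2,y2,z2)`, `(x3,y3,z3)`. -/
lemma isomS {a b c d e f a' b' c' d' e' f' : ℤ_[p]} (x1 y1 z1 x2 y2 z2 x3 y3 z3 : ℤ_[p])
    (hu : IsUnit (x1 * (y2 * z3 - y3 * z2) - x2 * (y1 * z3 - y3 * z1) + x3 * (y1 * z2 - y2 * z1)))
    (ha : a' = a * x1 ^ 2 + d * y1 ^ 2 + f * z1 ^ 2 +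
      2 * (b * x1 * y1 + c * x1 * z1 + e * y1 * z1))
    (hb : b' = a * x1 * x2 + d * y1 * y2 + f * z1 * z2 +
      (b * (x1 * y2 + y1 * x2) + c * (x1 * z2 + z1 * x2) + e * (y1 * z2 + z1 * y2)))
    (hc : c' = a * x1 * x3 + d * y1 * y3 + f * z1 * z3 +
      (b * (x1 * y3 + y1 * x3) + c * (x1 * z3 + z1 * x3) + e * (y1 * z3 + z1 * y3)))
    (hd : d' = a * x2 ^ 2 + d * y2 ^ 2 + f * z2 ^ 2 +
      2 * (b * x2 * y2 + c * x2 * z2 + e * y2 * z2))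
    (he : e' = a * x2 * x3 + d * y2 * y3 + f * z2 * z3 +
      (b * (x2 * y3 + y2 * x3) + c * (x2 * z3 + z2 * x3) + e * (y2 * z3 + z2 * y3)))
    (hf : f' = a * x3 ^ 2 + d * y3 ^ 2 + f * z3 ^ 2 +
      2 * (b * x3 * y3 + c * x3 * z3 + e * y3 * z3)) :
    PadicIsomP p (symMat a b c d e f) (symMat a' b' c' d' e' f') := by
  refine ⟨!![x1, x2, x3; y1, y2, y3; z1, z2, z3], ?_, ?_⟩
  · convert hu using 1
    simp [Matrix.det_fin_three]; ring
  · subst ha hb hc hd he hf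
    ext i j
    fin_cases i <;> fin_cases j <;>
      simp [symMat, Matrix.mul_apply, Fin.sum_univ_three] <;> ring

lemma symMat_of_symm {M : Matrix (Fin 3) (Fin 3) ℤ_[p]} (h : M.IsSymm) :
    M = symMat (M 0 0) (M 0 1) (M 0 2) (M 1 1) (M 1 2) (M 2 2) := by
  ext i j
  fin_cases i <;> fin_cases j <;> simp [symMat]
  · exact h.apply 0 1
  · exact h.apply 0 2
  · exact h.apply 1 2

lemma hensel_quad (a b c t : ℤ_[p]) (h : (p : ℤ_[p]) ∣ a * t ^ 2 + b * t + c)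
    (hu : IsUnit (2 * a * t + b)) :
    ∃ x, a * x ^ 2 + b * x + c = 0 := by
  have h1 := PadicInt.isUnit_iff.1 hu
  have h2 := (PadicInt.norm_lt_one_iff_dvd _).2 h
  obtain ⟨z, hz, -⟩ := hensels_lemma (p := p) (R := ℤ_[p])
    (F := Polynomial.C a * Polynomial.X ^ 2 + Polynomial.C b * Polynomial.X + Polynomial.C c)
    (a := t) (by
      simp
      rw [show a * ((1 + 1) * t) + b = 2 * a * t + b by ring, h1]
      simpa using h2)
  exact ⟨z, by simpa using hz⟩

lemma exists_primitive {x : Fin 3 → ℤ_[p]} (hx : x ≠ 0) :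
    ∃ (c : ℤ_[p]) (y : Fin 3 → ℤ_[p]), c ≠ 0 ∧ x = c • y ∧ ∃ i, y i = 1 := by
  obtain ⟨i, hi⟩ := Finite.exists_max (fun i => ‖x i‖)
  have hxi : x i ≠ 0 := by
    intro h0
    apply hx
    ext1 j
    have := hi j
    simp only [h0, norm_zero] at this
    simpa using this
  have hd : ∀ j, x i ∣ x j := by
    intro j
    rcases ValuationRing.dvd_total (x i) (x j) with h | ⟨k, hk⟩
    · exact h
    · have h1 := hi j
      have hk1 : ‖k‖ = 1 := by
        apply le_antisymm (PadicInt.norm_le_one k)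
        have h2 : ‖x i‖ = ‖x j‖ * ‖k‖ := by rw [← norm_mul, ← hk]
        have h3 : 0 < ‖x i‖ := norm_pos_iff.2 hxi
        by_contra hlt
        push Not at hlt
        have h4 := norm_nonneg k
        nlinarith [norm_nonneg (x j)]
      have := (PadicInt.isUnit_iff.2 hk1)
      rw [hk]
      exact this.mul_right_dvd.2 dvd_rfl
  choose y hy using hd
  refine ⟨x i, y, hxi, ?_, i, ?_⟩
  · ext1 j; simp [← hy j]
  · have := hy i
    exact mul_left_cancel₀ hxi (by rw [← this, mul_one])

lemma isoMat_primitive {M : Matrix (Fin 3) (Fin 3) ℤ_[p]} (h : isoMat M) :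
    ∃ y : Fin 3 → ℤ_[p], (∃ i, y i = 1) ∧ quadVal M y = 0 := by
  obtain ⟨x, hx, hq⟩ := h
  obtain ⟨c, y, hc, rfl, hi⟩ := exists_primitive hx
  refine ⟨y, hi, ?_⟩
  rw [quadVal_eq, Matrix.mulVec_smul, dotProduct_smul, smul_dotProduct, ← quadVal_eq] at hq
  simpa [hc] using hq

lemma quadVal_symMat (a b c d e f : ℤ_[p]) (x : Fin 3 → ℤ_[p]) :
    quadVal (symMat a b c d e f) x = a * x 0 ^ 2 + d * x 1 ^ 2 + f * x 2 ^ 2 +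
      2 * (b * x 0 * x 1 + c * x 0 * x 2 + e * x 1 * x 2) := by
  simp [quadVal, symMat, Fin.sum_univ_three]; ring

lemma isUnit_two (hp2 : p ≠ 2) : IsUnit (2 : ℤ_[p]) := by
  rw [isUnit_iff_not_dvd]
  intro h
  have h1 := (PadicInt.pow_p_dvd_int_iff (p := p) 1 2).1 (by simpa using h)
  rw [pow_one] at h1
  have h2 : p ∣ 2 := by exact_mod_cast h1
  exact hp2 ((Nat.prime_dvd_prime_iff_eq Fact.out Nat.prime_two).1 h2)

lemma exists_lift (z : ZMod p) : ∃ x : ℤ_[p], PadicInt.toZMod x = z :=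
  ZMod.ringHom_surjective PadicInt.toZMod z

lemma toZMod_zero_iff (x : ℤ_[p]) : PadicInt.toZMod x = 0 ↔ (p : ℤ_[p]) ∣ x := by
  rw [← RingHom.mem_ker, PadicInt.ker_toZMod, PadicInt.maximalIdeal_eq_span_p,
    Ideal.mem_span_singleton]

lemma unit_rep_one (hp2 : p ≠ 2) {a b : ℤ_[p]} (ha : IsUnit a) (hb : IsUnit b) :
    ∃ x y : ℤ_[p], a * x ^ 2 + b * y ^ 2 = 1 := by
  have hodd : Fintype.card (ZMod p) % 2 = 1 := by
    rw [ZMod.card]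
    exact Nat.odd_iff.1 ((Fact.out : p.Prime).odd_of_ne_two hp2)
  have ha0 : PadicInt.toZMod a ≠ 0 := (ha.map _).ne_zero
  have hb0 : PadicInt.toZMod b ≠ 0 := (hb.map _).ne_zero
  obtain ⟨x, y, hxy⟩ := FiniteField.exists_root_sum_quadratic (R := ZMod p)
    (f := Polynomial.C (PadicInt.toZMod a) * Polynomial.X ^ 2)
    (g := Polynomial.C (PadicInt.toZMod b) * Polynomial.X ^ 2 + Polynomial.C 0 * Polynomial.X
      + Polynomial.C (-1))
    (Polynomial.degree_C_mul_X_pow 2 ha0) (Polynomial.degree_quadratic hb0) hodd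
  obtain ⟨x, rfl⟩ := exists_lift x
  obtain ⟨y, rfl⟩ := exists_lift y
  have hd : (p : ℤ_[p]) ∣ a * x ^ 2 + b * y ^ 2 - 1 := by
    rw [← toZMod_zero_iff]
    simp at hxy ⊢
    linear_combination hxy
  have h2 := isUnit_two hp2
  by_cases hx : IsUnit x
  · obtain ⟨x', hx'⟩ := hensel_quad a 0 (b * y ^ 2 - 1) x
      (by convert hd using 1; ring) (by simpa using (h2.mul ha).mul hx)
    exact ⟨x', y, by linear_combination hx'⟩
  · by_cases hy : IsUnit y
    · obtain ⟨y', hy'⟩ := hensel_quad b 0 (a * x ^ 2 - 1) y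
        (by convert hd using 1; ring) (by simpa using (h2.mul hb).mul hy)
      exact ⟨x, y', by linear_combination hy'⟩
    · exfalso
      rw [isUnit_iff_not_dvd, not_not] at hx hy
      obtain ⟨k, rfl⟩ := hx
      obtain ⟨l, rfl⟩ := hy
      have : (p : ℤ_[p]) ∣ 1 := by
        rw [← dvd_sub_right (a := (p : ℤ_[p])) (b := a * (p * k) ^ 2 + b * (p * l) ^ 2)]
        · exact hd
        · exact ⟨a * p * k ^ 2 + b * p * l ^ 2, by ring⟩
      exact prime_p.not_isUnit (isUnit_of_dvd_one this)

lemma nonunit_iff (x : ℤ_[p]) : ¬ IsUnit x ↔ (p : ℤ_[p]) ∣ x := by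
  rw [isUnit_iff_not_dvd, not_not]

lemma unit_add {x y : ℤ_[p]} (hx : IsUnit x) (hy : (p : ℤ_[p]) ∣ y) : IsUnit (x + y) := by
  rw [isUnit_iff_not_dvd] at *
  rwa [dvd_add_left hy]

lemma isomP_refl (M : Matrix (Fin 3) (Fin 3) ℤ_[p]) : PadicIsomP p M M :=
  ⟨1, by simp, by simp⟩

/-- Move a unit diagonal entry to the first place. -/
lemma diag_unit_first (a b c d e f : ℤ_[p]) (h : IsUnit a ∨ IsUnit d ∨ IsUnit f) :
    ∃ a' b' c' d' e' f', IsUnit a' ∧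
      PadicIsomP p (symMat a b c d e f) (symMat a' b' c' d' e' f') := by
  rcases h with h | h | h
  · exact ⟨_, _, _, _, _, _, h, isomP_refl _⟩
  · exact ⟨d, b, e, a, c, f, h, isomS 0 1 0 1 0 0 0 0 1 (by simp) (by ring) (by ring) (by ring)
      (by ring) (by ring) (by ring)⟩
  · exact ⟨f, e, c, d, b, a, h, isomS 0 0 1 0 1 0 1 0 0 (by simp) (by ring) (by ring) (by ring)
      (by ring) (by ring) (by ring)⟩

lemma odd_unit_first (hp2 : p ≠ 2) (a b c d e f : ℤ_[p])
    (h : ¬ ((p : ℤ_[p]) ∣ a ∧ (p : ℤ_[p]) ∣ b ∧ (p : ℤ_[p]) ∣ c ∧ (p : ℤ_[p]) ∣ d ∧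
      (p : ℤ_[p]) ∣ e ∧ (p : ℤ_[p]) ∣ f)) :
    ∃ a' b' c' d' e' f', IsUnit a' ∧
      PadicIsomP p (symMat a b c d e f) (symMat a' b' c' d' e' f') := by
  by_cases hu : IsUnit a ∨ IsUnit d ∨ IsUnit f
  · exact diag_unit_first a b c d e f hu
  push Not at hu
  simp only [nonunit_iff] at hu
  obtain ⟨ha, hd, hf⟩ := hu
  have h2 := isUnit_two hp2
  by_cases hb : IsUnit b
  · refine ⟨_, _, _, _, _, _, ?_, isomS 1 1 0 0 1 0 0 0 1 (by simp) rfl rfl rfl rfl rfl rfl⟩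
    convert unit_add (h2.mul hb) (dvd_add ha hd) using 1; ring
  by_cases hc : IsUnit c
  · refine ⟨_, _, _, _, _, _, ?_, isomS 1 0 1 0 1 0 0 0 1 (by simp) rfl rfl rfl rfl rfl rfl⟩
    convert unit_add (h2.mul hc) (dvd_add ha hf) using 1; ring
  by_cases he : IsUnit e
  · refine ⟨_, _, _, _, _, _, ?_, isomS 0 1 1 1 0 0 0 0 1 (by simp) rfl rfl rfl rfl rfl rfl⟩
    convert unit_add (h2.mul he) (dvd_add hd hf) using 1; ring
  rw [nonunit_iff] at hb hc he
  exact absurd ⟨ha, hb, hc, hd, he, hf⟩ h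

lemma split_one {a : ℤ_[p]} (b c d e f : ℤ_[p]) (ha : IsUnit a) :
    ∃ d' e' f', PadicIsomP p (symMat a b c d e f) (symMat a 0 0 d' e' f') := by
  obtain ⟨i, hi⟩ := ha.exists_right_inv
  exact ⟨_, _, _, isomS 1 0 0 (-(b * i)) 1 0 (-(c * i)) 0 1 (by simp) (by ring)
    (by linear_combination b * hi) (by linear_combination c * hi) rfl rfl rfl⟩

lemma split_one' {a d : ℤ_[p]} (e f : ℤ_[p]) (ha : IsUnit d) :
    ∃ f', PadicIsomP p (symMat a 0 0 d e f) (symMat a 0 0 d 0 f') := by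
  obtain ⟨i, hi⟩ := ha.exists_right_inv
  exact ⟨_, isomS 1 0 0 0 1 0 0 (-(e * i)) 1 (by simp) (by ring)
    (by ring) (by ring) (by ring) (by linear_combination e * hi) rfl⟩

lemma odd_diag (hp2 : p ≠ 2) {M : Matrix (Fin 3) (Fin 3) ℤ_[p]} (hM : M.IsSymm)
    (hd : ¬ (p : ℤ_[p]) ^ 2 ∣ M.det) :
    ∃ a b c, IsUnit a ∧ IsUnit b ∧ PadicIsomP p M (symMat a 0 0 b 0 c) := by
  have h2 := isUnit_two hp2
  have key : ∀ N, PadicIsomP p M N → ¬ (p : ℤ_[p]) ^ 2 ∣ N.det := by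
    intro N hN hdv
    obtain ⟨u, hu, hdet⟩ := isomP_det hN
    rw [hdet, (hu.pow 2).dvd_mul_left] at hdv
    exact hd hdv
  have e0 := symMat_of_symm hM
  generalize M 0 0 = a, M 0 1 = b, M 0 2 = c, M 1 1 = d, M 1 2 = e, M 2 2 = f at e0
  have hent : ¬ ((p : ℤ_[p]) ∣ a ∧ (p : ℤ_[p]) ∣ b ∧ (p : ℤ_[p]) ∣ c ∧ (p : ℤ_[p]) ∣ d ∧
      (p : ℤ_[p]) ∣ e ∧ (p : ℤ_[p]) ∣ f) := by
    rintro ⟨⟨a, rfl⟩, ⟨b, rfl⟩, ⟨c, rfl⟩, ⟨d, rfl⟩, ⟨e, rfl⟩, ⟨f, rfl⟩⟩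
    apply hd
    rw [e0, symMat_det]
    exact ⟨p * (a * d * f + 2 * b * c * e - a * e ^ 2 - d * c ^ 2 - f * b ^ 2), by ring⟩
  obtain ⟨a, b, c, d, e, f, ha, h1⟩ := odd_unit_first hp2 a b c d e f hent
  rw [← e0] at h1
  obtain ⟨d, e, f, h3⟩ := split_one b c d e f ha
  have h4 := isomP_trans h1 h3
  have h5 : ∃ d' e' f', IsUnit d' ∧ PadicIsomP p (symMat a 0 0 d e f) (symMat a 0 0 d' e' f') := by
    by_cases hd : IsUnit d
    · exact ⟨d, e, f, hd, isomP_refl _⟩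
    by_cases hf : IsUnit f
    · exact ⟨f, e, d, hf, isomS 1 0 0 0 0 1 0 1 0 (by simp) (by ring) (by ring) (by ring)
        (by ring) (by ring) (by ring)⟩
    rw [nonunit_iff] at hd hf
    by_cases he : IsUnit e
    · refine ⟨_, _, _, ?_, isomS 1 0 0 0 1 1 0 0 1 (by simp) (by ring) (by ring) (by ring)
        rfl rfl rfl⟩
      convert unit_add (h2.mul he) (dvd_add hd hf) using 1; ring
    exfalso
    rw [nonunit_iff] at he
    obtain ⟨d, rfl⟩ := hd
    obtain ⟨e, rfl⟩ := he
    obtain ⟨f, rfl⟩ := hf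
    apply key _ h4
    rw [symMat_det]
    exact ⟨a * (d * f - e ^ 2), by ring⟩
  obtain ⟨d, e, f, hd, h6⟩ := h5
  obtain ⟨f, h7⟩ := split_one' (a := a) e f hd
  exact ⟨a, d, f, ha, hd, isomP_trans (isomP_trans h4 h6) h7⟩

lemma odd_diag_one (hp2 : p ≠ 2) {M : Matrix (Fin 3) (Fin 3) ℤ_[p]} (hM : M.IsSymm)
    (hd : ¬ (p : ℤ_[p]) ^ 2 ∣ M.det) :
    ∃ b c, IsUnit b ∧ PadicIsomP p M (symMat 1 0 0 b 0 c) := by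
  obtain ⟨a, b, c, ha, hb, h⟩ := odd_diag hp2 hM hd
  obtain ⟨x, y, hxy⟩ := unit_rep_one hp2 ha hb
  refine ⟨a * b, c, ha.mul hb, isomP_trans h (isomS x y 0 (-b * y) (a * x) 0 0 0 1 ?_
    ?_ ?_ ?_ ?_ ?_ ?_)⟩
  · convert isUnit_one using 1; linear_combination hxy
  · linear_combination -hxy
  · ring
  · ring
  · linear_combination (-a * b) * hxy
  · ring
  · ring

lemma rescale {a b c d e f : ℤ_[p]} (f' : ℤ_[p]) {u : ℤ_[p]} (hu : IsUnit u)
    (h : f' = u ^ 2 * f) (hc : c = 0) (he : e = 0) :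
    PadicIsomP p (symMat a b c d e f) (symMat a b c d e f') := by
  subst hc he
  exact isomS 1 0 0 0 1 0 0 0 u (by simpa using hu) (by ring) (by ring) (by ring)
    (by ring) (by ring) (by rw [h]; ring)

lemma diagonal_eq (x y z : ℤ_[p]) : Matrix.diagonal ![x, y, z] = symMat x 0 0 y 0 z := by
  ext i j
  fin_cases i <;> fin_cases j <;> simp [symMat]

/-- If the determinant `g * f` of `B ⊥ ⟨f⟩` is `u² D`, then `⟨f⟩` can be rescaled to
`⟨g' D⟩` as soon as `g g' s² = 1`. -/
lemma finish {M : Matrix (Fin 3) (Fin 3) ℤ_[p]} {a b d f : ℤ_[p]}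
    (h : PadicIsomP p M (symMat a b 0 d 0 f)) (g' : ℤ_[p]) {s : ℤ_[p]} (hs : IsUnit s)
    (hg : (a * d - b ^ 2) * g' = s ^ 2) (hg0 : IsUnit (a * d - b ^ 2)) :
    PadicIsomP p M (symMat a b 0 d 0 (g' * M.det)) := by
  obtain ⟨u, hu, hdet⟩ := isomP_det h
  rw [symMat_det] at hdet
  obtain ⟨i, hi⟩ := hu.exists_right_inv
  have hiu : IsUnit i := IsUnit.of_mul_eq_one u (by rw [mul_comm]; exact hi)
  refine isomP_trans h (rescale _ (hs.mul hiu) ?_ rfl rfl)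
  have h1 : (a * d - b ^ 2) * f = u ^ 2 * M.det := by linear_combination hdet
  apply hg0.mul_left_cancel
  linear_combination M.det * hg - s ^ 2 * i ^ 2 * h1 - s ^ 2 * M.det * (1 + u * i) * hi

theorem odd_case_zero (hp2 : p ≠ 2) {M : Matrix (Fin 3) (Fin 3) ℤ_[p]} (hM : M.IsSymm)
    (hd : IsUnit M.det) : PadicIsomP p M (Matrix.diagonal ![1, 1, M.det]) := by
  have hd2 : ¬ (p : ℤ_[p]) ^ 2 ∣ M.det := by
    intro h
    exact (isUnit_iff_not_dvd _).1 hd ((dvd_pow_self _ two_ne_zero).trans h)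
  obtain ⟨b, c, hb, h⟩ := odd_diag_one hp2 hM hd2
  obtain ⟨u, hu, hdet⟩ := isomP_det h
  have hc : IsUnit c := by
    have : IsUnit (b * c) := by
      have h1 := (hu.pow 2).mul hd
      rw [← hdet, symMat_det] at h1
      convert h1 using 1; ring
    exact isUnit_of_mul_isUnit_right this
  obtain ⟨x, y, hxy⟩ := unit_rep_one hp2 hb hc
  have h2 : PadicIsomP p (symMat 1 0 0 b 0 c) (symMat 1 0 0 1 0 (b * c)) := by
    refine isomS 1 0 0 0 x y 0 (-c * y) (b * x) ?_ ?_ ?_ ?_ ?_ ?_ ?_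
    · convert isUnit_one using 1; linear_combination hxy
    · ring
    · ring
    · ring
    · linear_combination -hxy
    · ring
    · linear_combination (-b * c) * hxy
  have h3 := finish (isomP_trans h h2) 1 (s := 1) isUnit_one (by ring) (by simp)
  rw [diagonal_eq]
  simpa using h3

theorem odd_case_one (hp2 : p ≠ 2) {M : Matrix (Fin 3) (Fin 3) ℤ_[p]} (hM : M.IsSymm)
    (hd1 : (p : ℤ_[p]) ∣ M.det) (hd2 : ¬ (p : ℤ_[p]) ^ 2 ∣ M.det) :
    (isoMat M → PadicIsomP p M (Matrix.diagonal ![1, -1, -M.det])) ∧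
    (¬ isoMat M → ∃ Δ : ℤ_[p], IsUnit Δ ∧ (¬∃ u : ℤ_[p], u ^ 2 = Δ) ∧
          PadicIsomP p M (Matrix.diagonal ![1, -Δ, -Δ * M.det])) := by
  obtain ⟨b, c, hb, h⟩ := odd_diag_one hp2 hM hd2
  rw [isoMat_iff h]
  have h2 := isUnit_two hp2
  refine ⟨fun hiso => ?_, fun hiso => ?_⟩
  · obtain ⟨y, hy1, hq⟩ := isoMat_primitive hiso
    rw [quadVal_symMat] at hq
    obtain ⟨u, hu, hdet⟩ := isomP_det h
    have hpc : (p : ℤ_[p]) ∣ c := by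
      have h1 : (p : ℤ_[p]) ∣ b * c := by
        have := hd1.mul_left (u ^ 2)
        rw [← hdet, symMat_det] at this
        convert this using 1; ring
      rwa [hb.dvd_mul_left] at h1
    have hpc2 : ¬ (p : ℤ_[p]) ^ 2 ∣ c := by
      intro hc
      apply hd2
      rw [← (hu.pow 2).dvd_mul_left, ← hdet, symMat_det]
      convert hc.mul_left b using 1; ring
    obtain ⟨k, rfl⟩ := hpc
    have hy : IsUnit (y 1) := by
      by_contra hy
      rw [nonunit_iff] at hy
      have hx : (p : ℤ_[p]) ∣ y 0 := by
        apply prime_p.dvd_of_dvd_pow (n := 2)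
        obtain ⟨m, hm⟩ := hy
        exact ⟨-(b * m * y 1 + k * y 2 ^ 2), by rw [hm] at hq ⊢; linear_combination hq⟩
      obtain ⟨m, hm⟩ := hy
      obtain ⟨n, hn⟩ := hx
      have hp0 : (p : ℤ_[p]) ≠ 0 := prime_p.ne_zero
      have hkz : (p : ℤ_[p]) ∣ k * y 2 ^ 2 := by
        refine ⟨-(n ^ 2 + b * m ^ 2), ?_⟩
        apply mul_left_cancel₀ hp0
        rw [hm, hn] at hq
        linear_combination hq
      have hz : (p : ℤ_[p]) ∣ y 2 := by
        rcases prime_p.dvd_or_dvd hkz with hk | hz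
        · obtain ⟨l, rfl⟩ := hk
          exact absurd ⟨l, by ring⟩ hpc2
        · exact prime_p.dvd_of_dvd_pow hz
      obtain ⟨i, hi⟩ := hy1
      have : (p : ℤ_[p]) ∣ y i := by
        fin_cases i
        · exact ⟨n, hn⟩
        · exact ⟨m, hm⟩
        · exact hz
      rw [hi] at this
      exact prime_p.not_isUnit (isUnit_of_dvd_one this)
    obtain ⟨i, hi⟩ := hy.exists_right_inv
    have hx : IsUnit (y 0) := by
      by_contra hx
      rw [nonunit_iff] at hx
      obtain ⟨n, hn⟩ := hx
      have : (p : ℤ_[p]) ∣ b * y 1 ^ 2 :=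
        ⟨-(n * y 0 + k * y 2 ^ 2), by rw [hn] at hq ⊢; linear_combination hq⟩
      exact (isUnit_iff_not_dvd _).1 (hb.mul (hy.pow 2)) this
    have hiu : IsUnit i := IsUnit.of_mul_eq_one (y 1) (by rw [mul_comm]; exact hi)
    obtain ⟨s, hs⟩ := hensel_quad 1 0 b (y 0 * i)
      ⟨- k * y 2 ^ 2 * i ^ 2, by linear_combination i ^ 2 * hq - b * (1 + y 1 * i) * hi⟩
      (by simpa using h2.mul (hx.mul hiu))
    have hsu : IsUnit s := by
      have : IsUnit (s * s) := by
        rw [← IsUnit.neg_iff]; convert hb using 1; linear_combination -hs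
      exact isUnit_of_mul_isUnit_left this
    obtain ⟨j, hj⟩ := hsu.exists_right_inv
    have hju : IsUnit j := IsUnit.of_mul_eq_one s (by rw [mul_comm]; exact hj)
    have h3 : PadicIsomP p (symMat 1 0 0 b 0 (p * k)) (symMat 1 0 0 (-1) 0 (p * k)) := by
      refine isomS 1 0 0 0 j 0 0 0 1 (by simpa using hju) ?_ ?_ ?_ ?_ ?_ ?_
      · ring
      · ring
      · ring
      · linear_combination (1 + s * j) * hj - j ^ 2 * hs
      · ring
      · ring
    have h4 := finish (isomP_trans h h3) (-1) (s := 1) isUnit_one (by ring) (by simp)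
    rw [diagonal_eq]
    simpa using h4
  · refine ⟨-b, hb.neg, ?_, ?_⟩
    · rintro ⟨u, hu⟩
      apply hiso
      refine ⟨![u, 1, 0], fun h0 => ?_, ?_⟩
      · have := congrFun h0 1
        simp at this
      · rw [quadVal_symMat]; simp; linear_combination hu
    · have h4 := finish h b (s := b) hb (by ring) (by simpa using hb)
      rw [diagonal_eq]
      simpa using h4

/-! ### The prime two -/

lemma even_or_odd (x : ℤ_[2]) : (∃ k, x = 2 * k) ∨ (∃ k, x = 2 * k + 1) := by
  have h : ∀ z : ZMod 2, z = 0 ∨ z = 1 := by decide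
  rcases h (PadicInt.toZMod x) with h | h
  · left
    rw [toZMod_zero_iff] at h
    exact_mod_cast h
  · right
    have h1 : PadicInt.toZMod (x - 1) = 0 := by rw [map_sub, h, map_one, sub_self]
    rw [toZMod_zero_iff] at h1
    obtain ⟨k, hk⟩ := h1
    exact ⟨k, by push_cast at hk; linear_combination hk⟩

lemma unit_odd (k : ℤ_[2]) : IsUnit (2 * k + 1) := by
  have := unit_add (p := 2) (x := 1) (y := 2 * k) isUnit_one ⟨k, by push_cast; ring⟩
  rwa [add_comm] at this

lemma not_unit_even (k : ℤ_[2]) : ¬ IsUnit (2 * k) := by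
  rw [nonunit_iff]; exact ⟨k, by push_cast; ring⟩

lemma odd_of_unit {x : ℤ_[2]} (h : IsUnit x) : ∃ k, x = 2 * k + 1 := by
  rcases even_or_odd x with ⟨k, rfl⟩ | h'
  · exact absurd h (not_unit_even k)
  · exact h'

lemma even_of_nonunit {x : ℤ_[2]} (h : ¬ IsUnit x) : ∃ k, x = 2 * k := by
  rcases even_or_odd x with h' | ⟨k, rfl⟩
  · exact h'
  · exact absurd (unit_odd k) h

lemma unit_add_even {x : ℤ_[2]} (h : IsUnit x) (k : ℤ_[2]) : IsUnit (2 * k + x) := by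
  obtain ⟨l, rfl⟩ := odd_of_unit h
  convert unit_odd (k + l) using 1; ring

lemma hensel_two (a b k : ℤ_[2]) (hb : IsUnit b) : ∃ x, a * x ^ 2 + b * x + 2 * k = 0 :=
  hensel_quad a b (2 * k) 0 ⟨k, by push_cast; ring⟩ (by simpa using hb)

/-- Split off a unimodular binary block. -/
lemma split_two {a b d : ℤ_[p]} (c e f : ℤ_[p]) (h : IsUnit (a * d - b ^ 2)) :
    ∃ f', PadicIsomP p (symMat a b c d e f) (symMat a b 0 d 0 f') := by
  obtain ⟨i, hi⟩ := h.exists_right_inv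
  exact ⟨_, isomS 1 0 0 0 1 0 (-(d * c - b * e) * i) (-(a * e - b * c) * i) 1 (by simp)
    (by ring) (by ring) (by linear_combination c * hi) (by ring) (by linear_combination e * hi) rfl⟩

lemma hyp_of_even (a b m f : ℤ_[2]) (hb : IsUnit b) :
    PadicIsomP 2 (symMat (2 * a) b 0 (2 * (2 * m)) 0 f) (symMat 0 1 0 0 0 f) := by
  obtain ⟨x, hx⟩ := hensel_two a b m hb
  have hw : IsUnit (2 * (a * x) + b) := unit_add_even hb _
  obtain ⟨j, hj⟩ := hw.exists_right_inv
  have hju : IsUnit j := IsUnit.of_mul_eq_one _ (by rw [mul_comm]; exact hj)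
  refine isomS (1 - a * j * x) (-(a * j)) 0 (x * j) j 0 0 0 1 ?_ ?_ ?_ ?_ ?_ ?_ ?_
  · convert hju using 1; ring
  · linear_combination (2 * a) * hj - 2 * (a * j) ^ 2 * hx
  · linear_combination 2 * a * j ^ 2 * hx - hj
  · ring
  · linear_combination -2 * j ^ 2 * hx
  · ring
  · ring

lemma binary_class (a b c f : ℤ_[2]) (hb : IsUnit b) :
    PadicIsomP 2 (symMat (2 * a) b 0 (2 * c) 0 f) (symMat 0 1 0 0 0 f) ∨
    PadicIsomP 2 (symMat (2 * a) b 0 (2 * c) 0 f) (symMat 2 1 0 2 0 f) := by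
  rcases even_or_odd c with ⟨m, rfl⟩ | ⟨m, rfl⟩
  · exact Or.inl (hyp_of_even a b m f hb)
  rcases even_or_odd a with ⟨n, rfl⟩ | ⟨n, rfl⟩
  · left
    refine isomP_trans ?_ (hyp_of_even (2 * m + 1) b n f hb)
    exact isomS 0 1 0 1 0 0 0 0 1 (by simp) (by ring) (by ring) (by ring) (by ring) (by ring)
      (by ring)
  right
  have hau := unit_odd n
  generalize 2 * n + 1 = a at hau
  obtain ⟨x, hx⟩ := hensel_two a b m hb
  have hw : IsUnit (2 * (a * x) + b) := unit_add_even hb _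
  obtain ⟨j, hj⟩ := hw.exists_right_inv
  have hju : IsUnit j := IsUnit.of_mul_eq_one _ (by rw [mul_comm]; exact hj)
  have h1 : PadicIsomP 2 (symMat (2 * a) b 0 (2 * (2 * m + 1)) 0 f)
      (symMat 2 1 0 (2 * (a * j ^ 2)) 0 f) := by
    refine isomS x 1 0 j 0 0 0 0 1 ?_ ?_ ?_ ?_ ?_ ?_ ?_
    · convert hju.neg using 1; ring
    · linear_combination -2 * hx
    · linear_combination -hj
    · ring
    · ring
    · ring
    · ring
  refine isomP_trans h1 ?_
  obtain ⟨k, hk⟩ := odd_of_unit (hau.mul (hju.pow 2))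
  rw [hk]
  have hD : IsUnit (4 * (2 * k + 1) - 1 : ℤ_[2]) := by
    convert unit_odd (4 * k + 1) using 1; ring
  obtain ⟨y, hy⟩ := hensel_two (4 * (2 * k + 1) - 1) (-(4 * (2 * k + 1) - 1)) k hD.neg
  refine isomS 1 0 0 y (1 - 2 * y) 0 0 0 1 ?_ ?_ ?_ ?_ ?_ ?_ ?_
  · convert unit_odd (-y) using 1; ring
  · ring
  · ring
  · ring
  · linear_combination -2 * hy
  · ring
  · ring

/-- Splitting off an even unimodular plane, odd determinant. -/
lemma even_plane_unit {M : Matrix (Fin 3) (Fin 3) ℤ_[2]} (hM : M.IsSymm) (hd : IsUnit M.det) :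
    ∃ a b c f, IsUnit b ∧ PadicIsomP 2 M (symMat (2 * a) b 0 (2 * c) 0 f) := by
  have key : ∀ N, PadicIsomP 2 M N → IsUnit N.det := by
    intro N hN
    obtain ⟨u, hu, hdet⟩ := isomP_det hN
    rw [hdet]; exact (hu.pow 2).mul hd
  have e0 := symMat_of_symm hM
  generalize M 0 0 = a, M 0 1 = b, M 0 2 = c, M 1 1 = d, M 1 2 = e, M 2 2 = f at e0
  have hent : IsUnit a ∨ IsUnit d ∨ IsUnit f := by
    by_contra hu
    push Not at hu
    obtain ⟨ha, hd', hf⟩ := hu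
    obtain ⟨a, rfl⟩ := even_of_nonunit ha
    obtain ⟨d, rfl⟩ := even_of_nonunit hd'
    obtain ⟨f, rfl⟩ := even_of_nonunit hf
    rw [e0, symMat_det] at hd
    refine not_unit_even (4 * a * d * f + b * c * e - a * e ^ 2 - d * c ^ 2 - f * b ^ 2) ?_
    convert hd using 1; ring
  obtain ⟨a, b, c, d, e, f, ha, h1⟩ := diag_unit_first a b c d e f hent
  rw [← e0] at h1
  obtain ⟨d, e, f, h3⟩ := split_one b c d e f ha
  have h4 := isomP_trans h1 h3
  by_cases hdf : IsUnit d ∨ IsUnit f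
  · have h5 : ∃ d' e' f', IsUnit d' ∧
        PadicIsomP 2 (symMat a 0 0 d e f) (symMat a 0 0 d' e' f') := by
      rcases hdf with hd | hf
      · exact ⟨d, e, f, hd, isomP_refl _⟩
      · exact ⟨f, e, d, hf, isomS 1 0 0 0 0 1 0 1 0 (by simp) (by ring) (by ring) (by ring)
          (by ring) (by ring) (by ring)⟩
    obtain ⟨d, e, f, hdu, h6⟩ := h5
    obtain ⟨f, h7⟩ := split_one' (a := a) e f hdu
    have h8 := isomP_trans h4 (isomP_trans h6 h7)
    have hfu : IsUnit f := by
      have := key _ h8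
      rw [symMat_det] at this
      refine isUnit_of_mul_isUnit_right (x := a * d) ?_
      convert this using 1; ring
    obtain ⟨k, rfl⟩ := odd_of_unit ha
    obtain ⟨l, rfl⟩ := odd_of_unit hdu
    obtain ⟨m, rfl⟩ := odd_of_unit hfu
    have h9 : PadicIsomP 2 (symMat (2 * k + 1) 0 0 (2 * l + 1) 0 (2 * m + 1))
        (symMat (2 * (k + l + 1)) (2 * l + 1) 0 (2 * (l + m + 1)) (2 * m + 1) (2 * m + 1)) :=
      isomS 1 1 0 0 1 1 0 0 1 (by simp) (by ring) (by ring) (by ring) (by ring) (by ring)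
        (by ring)
    obtain ⟨f', h10⟩ := split_two (a := 2 * (k + l + 1)) (b := 2 * l + 1)
      (d := 2 * (l + m + 1)) 0 (2 * m + 1) (2 * m + 1) (by
        convert unit_odd (2 * (k + l + 1) * (l + m + 1) - 2 * l ^ 2 - 2 * l - 1) using 1; ring)
    exact ⟨_, _, _, _, hdu, isomP_trans h8 (isomP_trans h9 h10)⟩
  · push Not at hdf
    obtain ⟨d, rfl⟩ := even_of_nonunit hdf.1
    obtain ⟨f, rfl⟩ := even_of_nonunit hdf.2
    have he : IsUnit e := by
      by_contra he
      obtain ⟨e, rfl⟩ := even_of_nonunit he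
      have := key _ h4
      rw [symMat_det] at this
      refine not_unit_even (a * d * f * 2 - 2 * a * e ^ 2) ?_
      convert this using 1; ring
    refine ⟨d, e, f, a, he, isomP_trans h4 ?_⟩
    exact isomS 0 1 0 0 0 1 1 0 0 (by simp) (by ring) (by ring) (by ring) (by ring) (by ring)
      (by ring)

/-- Splitting off an even unimodular plane, even lattice. -/
lemma even_plane_even {M : Matrix (Fin 3) (Fin 3) ℤ_[2]} (hM : M.IsSymm)
    (hd : ¬ (2 : ℤ_[2]) ^ 2 ∣ M.det) (he : ∀ i, (2 : ℤ_[2]) ∣ M i i) :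
    ∃ a b c f, IsUnit b ∧ PadicIsomP 2 M (symMat (2 * a) b 0 (2 * c) 0 f) := by
  have e0 := symMat_of_symm hM
  obtain ⟨a, ha⟩ := he 0
  obtain ⟨d, hd'⟩ := he 1
  obtain ⟨f, hf⟩ := he 2
  rw [ha, hd', hf] at e0
  generalize M 0 1 = b, M 0 2 = c, M 1 2 = e at e0
  have h1 : ∃ a' b' c' d' e' f', IsUnit b' ∧
      PadicIsomP 2 (symMat (2 * a) b c (2 * d) e (2 * f))
        (symMat (2 * a') b' c' (2 * d') e' (2 * f')) := by
    by_cases hb : IsUnit b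
    · exact ⟨_, _, _, _, _, _, hb, isomP_refl _⟩
    by_cases hc : IsUnit c
    · exact ⟨a, c, b, f, e, d, hc, isomS 1 0 0 0 0 1 0 1 0 (by simp) (by ring) (by ring) (by ring)
          (by ring) (by ring) (by ring)⟩
    by_cases he : IsUnit e
    · exact ⟨d, e, b, f, c, a, he, isomS 0 1 0 0 0 1 1 0 0 (by simp) (by ring) (by ring) (by ring)
          (by ring) (by ring) (by ring)⟩
    exfalso
    obtain ⟨b, rfl⟩ := even_of_nonunit hb
    obtain ⟨c, rfl⟩ := even_of_nonunit hc
    obtain ⟨e, rfl⟩ := even_of_nonunit he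
    apply hd
    rw [e0, symMat_det]
    exact ⟨2 * (a * d * f + 2 * b * c * e - a * e ^ 2 - d * c ^ 2 - f * b ^ 2), by ring⟩
  obtain ⟨a, b, c, d, e, f, hb, h2⟩ := h1
  rw [← e0] at h2
  obtain ⟨f', h3⟩ := split_two (a := 2 * a) (b := b) (d := 2 * d) c e (2 * f) (by
    convert unit_add_even (hb.pow 2).neg (2 * a * d) using 1; ring)
  exact ⟨a, b, d, f', hb, isomP_trans h2 h3⟩

lemma aniso_unit {f : ℤ_[2]} (hf : IsUnit f) : ¬ isoMat (symMat 2 1 0 2 0 f) := by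
  intro h
  obtain ⟨y, ⟨i, hi⟩, hq⟩ := isoMat_primitive h
  rw [quadVal_symMat] at hq
  have hz : ¬ IsUnit (y 2) := by
    intro hz
    refine not_unit_even (-(y 0 ^ 2 + y 1 ^ 2 + y 0 * y 1)) ?_
    convert hf.mul (hz.pow 2) using 1
    linear_combination -hq
  obtain ⟨z, hz⟩ := even_of_nonunit hz
  have h2 : y 0 ^ 2 + y 1 ^ 2 + y 0 * y 1 = 2 * (-(f * z ^ 2)) := by
    apply mul_left_cancel₀ (two_ne_zero : (2 : ℤ_[2]) ≠ 0)
    rw [hz] at hq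
    linear_combination hq
  have h3 : (∃ k, y 0 = 2 * k) ∧ (∃ k, y 1 = 2 * k) := by
    rcases even_or_odd (y 0) with ⟨k, hk⟩ | ⟨k, hk⟩ <;>
      rcases even_or_odd (y 1) with ⟨l, hl⟩ | ⟨l, hl⟩
    · exact ⟨⟨k, hk⟩, ⟨l, hl⟩⟩
    all_goals
      exfalso
      rw [hk, hl] at h2
      apply not_unit_even (-(f * z ^ 2))
      rw [← h2]
    · convert unit_odd (2 * k ^ 2 + 2 * l ^ 2 + 2 * l + 2 * k * l + k) using 1; ring
    · convert unit_odd (2 * k ^ 2 + 2 * l ^ 2 + 2 * k + 2 * k * l + l) using 1; ring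
    · convert unit_odd (2 * k ^ 2 + 2 * k + 2 * l ^ 2 + 2 * l + 2 * k * l + k + l + 1) using 1
      ring
  obtain ⟨⟨k, hk⟩, l, hl⟩ := h3
  have : ∃ m, y i = 2 * m := by
    fin_cases i
    · exact ⟨k, hk⟩
    · exact ⟨l, hl⟩
    · exact ⟨z, hz⟩
  obtain ⟨m, hm⟩ := this
  rw [hi] at hm
  exact not_unit_even m (hm ▸ isUnit_one)

lemma plane_swap {g : ℤ_[2]} (hg : IsUnit g) :
    ∃ f', PadicIsomP 2 (symMat 2 1 0 2 0 (2 * g)) (symMat 0 1 0 0 0 f') := by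
  obtain ⟨k, rfl⟩ := odd_of_unit hg
  obtain ⟨x, hx⟩ := hensel_two 1 1 (k + 1) isUnit_one
  have h1 : PadicIsomP 2 (symMat 2 1 0 2 0 (2 * (2 * k + 1)))
      (symMat (2 * 1) (2 * x + 1) 0 (2 * (2 * 0)) (2 * (2 * k + 1)) (2 * (2 * k + 1))) :=
    isomS 1 0 0 x 1 1 0 0 1 (by simp) (by ring) (by ring) (by ring)
      (by linear_combination -2 * hx) (by ring) (by ring)
  obtain ⟨f', h2⟩ := split_two (a := 2 * 1) (b := 2 * x + 1) (d := 2 * (2 * 0)) 0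
    (2 * (2 * k + 1)) (2 * (2 * k + 1)) (by
      convert ((unit_odd x).pow 2).neg using 1; ring)
  exact ⟨f', isomP_trans h1 (isomP_trans h2 (hyp_of_even 1 _ 0 f' (unit_odd x)))⟩

theorem two_case {M : Matrix (Fin 3) (Fin 3) ℤ_[2]} (hM : M.IsSymm)
    (hd : ¬ (2 : ℤ_[2]) ^ 2 ∣ M.det) (he : ¬ IsUnit M.det → ∀ i, (2 : ℤ_[2]) ∣ M i i) :
    (¬ isoMat M → PadicIsomP 2 M (symMat 2 1 0 2 0 (3 * M.det))) ∧
    (isoMat M → PadicIsomP 2 M (symMat 0 1 0 0 0 (-M.det))) := by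
  have h3u : IsUnit (3 : ℤ_[2]) := by convert unit_odd 1 using 1; norm_num
  obtain ⟨a, b, c, f, hb, h⟩ : ∃ a b c f, IsUnit b ∧
      PadicIsomP 2 M (symMat (2 * a) b 0 (2 * c) 0 f) := by
    by_cases hu : IsUnit M.det
    · exact even_plane_unit hM hu
    · exact even_plane_even hM hd (he hu)
  have hH : ∀ f, PadicIsomP 2 M (symMat 0 1 0 0 0 f) →
      PadicIsomP 2 M (symMat 0 1 0 0 0 (-M.det)) := by
    intro f hf
    have := finish hf (-1) (s := 1) isUnit_one (by ring) (by simp)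
    simpa using this
  rcases binary_class a b c f hb with h' | h'
  · have h1 := isomP_trans h h'
    refine ⟨fun hn => absurd ?_ hn, fun _ => hH _ h1⟩
    rw [isoMat_iff h1]
    refine ⟨![1, 0, 0], fun h0 => ?_, ?_⟩
    · have := congrFun h0 0
      simp at this
    · rw [quadVal_symMat]; simp
  · have h1 := isomP_trans h h'
    refine ⟨fun _ => finish h1 3 (s := 3) h3u (by ring) ?_, fun hi => ?_⟩
    · convert h3u using 1; ring
    rw [isoMat_iff h1] at hi
    have hfu : ¬ IsUnit f := fun hf => aniso_unit hf hi
    obtain ⟨g, rfl⟩ := even_of_nonunit hfu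
    have hg : IsUnit g := by
      by_contra hg
      obtain ⟨l, rfl⟩ := even_of_nonunit hg
      obtain ⟨u, hu, hdet⟩ := isomP_det h1
      apply hd
      rw [← (hu.pow 2).dvd_mul_left, ← hdet, symMat_det]
      exact ⟨3 * l, by ring⟩
    obtain ⟨f', h2⟩ := plane_swap hg
    exact hH _ (isomP_trans h1 h2)

end helpers

lemma det_ne_zero_of_isLat {A : TernMat} (hA : IsLat A) : A.det ≠ 0 := by
  intro h0
  obtain ⟨v, hv, hv0⟩ := Matrix.exists_mulVec_eq_zero_iff.2 h0
  have h1 := hA.2 v hv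
  have h2 : quadVal A v = v ⬝ᵥ (A *ᵥ v) := by
    simp [quadVal, dotProduct, Matrix.mulVec, Finset.mul_sum, mul_assoc]
  rw [h2, hv0, dotProduct_zero] at h1
  exact lt_irrefl _ h1

lemma padicMat_det (p : ℕ) [Fact p.Prime] (A : TernMat) :
    (padicMat p A).det = (A.det : ℤ_[p]) := by
  have := (Int.castRingHom ℤ_[p]).map_det A
  simpa [padicMat] using this.symm

lemma padicMat_symm (p : ℕ) [Fact p.Prime] {A : TernMat} (hA : A.IsSymm) :
    (padicMat p A).IsSymm := hA.map _

lemma pow_dvd_det_iff (p : ℕ) [Fact p.Prime] {A : TernMat} (hA : IsLat A) (n : ℕ) :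
    (p : ℤ_[p]) ^ n ∣ (padicMat p A).det ↔ n ≤ padicValInt p A.det := by
  rw [padicMat_det, PadicInt.pow_p_dvd_int_iff, padicValInt_dvd_iff]
  simp [det_ne_zero_of_isLat hA]

/-- Jordan splittings of the localizations of a stable ternary lattice. -/
theorem stable_local_structure (A : TernMat) (hA : IsLat A) (hst : IsStable A) :
    (∀ (p : ℕ) (hp : p.Prime), p ≠ 2 →
      letI : Fact p.Prime := ⟨hp⟩
      (padicValInt p A.det = 0 →
        PadicIsomP p (padicMat p A) (Matrix.diagonal ![1, 1, (A.det : ℤ_[p])])) ∧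
      (padicValInt p A.det = 1 → IsotropicP p A →
        PadicIsomP p (padicMat p A) (Matrix.diagonal ![1, -1, -(A.det : ℤ_[p])])) ∧
      (padicValInt p A.det = 1 → ¬IsotropicP p A →
        ∃ Δ : ℤ_[p], IsUnit Δ ∧ (¬∃ u : ℤ_[p], u ^ 2 = Δ) ∧
          PadicIsomP p (padicMat p A) (Matrix.diagonal ![1, -Δ, -Δ * (A.det : ℤ_[p])]))) ∧
    ((¬IsotropicP 2 A →
        PadicIsomP 2 (padicMat 2 A) !![2, 1, 0; 1, 2, 0; 0, 0, 3 * (A.det : ℤ_[2])]) ∧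
      (IsotropicP 2 A →
        PadicIsomP 2 (padicMat 2 A) !![0, 1, 0; 1, 0, 0; 0, 0, -(A.det : ℤ_[2])])) := by
  refine ⟨fun p hp hp2 => ?_, ?_⟩
  · haveI : Fact p.Prime := ⟨hp⟩
    have hs := padicMat_symm p hA.1
    rw [← padicMat_det p A]
    have key : padicValInt p A.det = 1 → (p : ℤ_[p]) ∣ (padicMat p A).det ∧
        ¬ (p : ℤ_[p]) ^ 2 ∣ (padicMat p A).det := by
      intro h
      have h1 := pow_dvd_det_iff p hA 1
      rw [pow_one] at h1
      rw [h1, pow_dvd_det_iff p hA 2]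
      omega
    refine ⟨fun h => odd_case_zero hp2 hs ?_,
      fun h => (odd_case_one hp2 hs (key h).1 (key h).2).1,
      fun h => (odd_case_one hp2 hs (key h).1 (key h).2).2⟩
    rw [isUnit_iff_not_dvd, ← pow_one (p : ℤ_[p]), pow_dvd_det_iff p hA 1]
    omega
  · have hs := padicMat_symm 2 hA.1
    obtain ⟨h1, h2⟩ := hst.2 2 Nat.prime_two
    have h2 := h2 rfl
    rw [← padicMat_det 2 A]
    refine two_case hs ?_ ?_
    · have := pow_dvd_det_iff 2 hA 2
      push_cast at this
      rw [this]; omega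
    · intro hu i
      rw [nonunit_iff, ← pow_one ((2 : ℕ) : ℤ_[2]), pow_dvd_det_iff 2 hA 1] at hu
      have hev := h2.1 (by omega) (Pi.single i 1)
      have : quadVal A (Pi.single i 1) = A i i := by
        simp [quadVal, Pi.single_apply]
      rw [this] at hev
      obtain ⟨k, hk⟩ := hev
      exact ⟨(k : ℤ_[2]), by simp [padicMat, hk]⟩
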